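/- arXiv:1408.4403 — 2 statements merged into one kernel-verified Lean document; each statement's English description precedes it below -/
import Mathlib

section
/- Consider the closed chain of N ≥ 6 sites and the supercharge Q₊ of the M₂ model defined from positive real weights λ_{1,1,x}, λ_{2,1,x}, λ_{2,2,x} (x ∈ ℤ/NℤZ). Then Q₊² = 0 if and only if the weights satisfy λ_{1,1,x+1} λ_{2,1,x} = λ_{1,1,x} λ_{2,2,x+1} for every x (indices mod N). -/
/-- A configuration of the closed M₂ chain of `N` sites: sites are labelled by
`ZMod N` and no three cyclically consecutive sites are occupied. -/
def ValidClosed (N : ℕ) (c : ZMod N → Bool) : Prop :=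
  ∀ x : ZMod N, ¬(c x = true ∧ c (x + 1) = true ∧ c (x + 2) = true)

instance (N : ℕ) [NeZero N] (c : ZMod N → Bool) : Decidable (ValidClosed N c) :=
  inferInstanceAs (Decidable
    (∀ x : ZMod N, ¬(c x = true ∧ c (x + 1) = true ∧ c (x + 2) = true)))

/-- Insert a particle at site `x`. -/
def addAtC {N : ℕ} (c : ZMod N → Bool) (x : ZMod N) : ZMod N → Bool :=
  fun y => if y = x then true else c y

/-- The fermionic string `(−1)^{number of occupied sites y < x}` for `x ∈ {1,…,N}`. -/
noncomputable def signClosed (N : ℕ) (c : ZMod N → Bool) (x : ℕ) : ℂ :=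
  (-1 : ℂ) ^ (((Finset.Ico 1 x).filter (fun y : ℕ => c (y : ZMod N) = true)).card)

/-- The amplitude with which the particle at `x` is removed: `λ_{2,1,x}` if `x` is the
first member of a pair, `λ_{2,2,x}` if it is the second member of a pair, and
`λ_{1,1,x}` if it is isolated. -/
noncomputable def ampQ {N : ℕ} (l11 l21 l22 : ZMod N → ℝ) (c : ZMod N → Bool)
    (x : ZMod N) : ℂ :=
  if c (x + 1) = true then ((l21 x : ℝ) : ℂ)
  else if c (x - 1) = true then ((l22 x : ℝ) : ℂ)
  else ((l11 x : ℝ) : ℂ)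

lemma natCast_zmod_inj_of_mem_Icc {N a b : ℕ} (ha : a ∈ Finset.Icc 1 N)
    (hb : b ∈ Finset.Icc 1 N) : (a : ZMod N) = b ↔ a = b := by
  refine ⟨fun h => ?_, fun h => h ▸ rfl⟩
  rw [Finset.mem_Icc] at ha hb
  rw [ZMod.natCast_eq_natCast_iff, Nat.modEq_iff_dvd] at h
  have := Int.eq_zero_of_abs_lt_dvd h (by rw [abs_lt]; constructor <;> omega)
  omega

lemma exists_mem_Icc_natCast_eq {N : ℕ} [NeZero N] (x : ZMod N) :
    ∃ a ∈ Finset.Icc 1 N, (a : ZMod N) = x := by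
  by_cases hx : x.val = 0
  · exact ⟨N, Finset.mem_Icc.2 ⟨Nat.one_le_iff_ne_zero.2 (NeZero.ne N), le_rfl⟩, by
      rw [ZMod.natCast_self, (ZMod.val_eq_zero x).1 hx]⟩
  · exact ⟨x.val, Finset.mem_Icc.2 ⟨Nat.one_le_iff_ne_zero.2 hx, (ZMod.val_lt x).le⟩,
      ZMod.natCast_zmod_val x⟩

lemma zmod_one_ne_zero {N : ℕ} (hN : 3 ≤ N) : (1 : ZMod N) ≠ 0 := by
  have h : ((1 : ℕ) : ZMod N) ≠ 0 := by
    rw [Ne, ZMod.natCast_eq_zero_iff]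
    exact fun h => absurd (Nat.le_of_dvd one_pos h) (by omega)
  simpa using h

lemma zmod_two_ne_zero {N : ℕ} (hN : 3 ≤ N) : (2 : ZMod N) ≠ 0 := by
  have h : ((2 : ℕ) : ZMod N) ≠ 0 := by
    rw [Ne, ZMod.natCast_eq_zero_iff]
    exact fun h => absurd (Nat.le_of_dvd two_pos h) (by omega)
  simpa using h

lemma addAtC_comm {N : ℕ} (c : ZMod N → Bool) (p q : ZMod N) :
    addAtC (addAtC c p) q = addAtC (addAtC c q) p := by
  funext y
  simp only [addAtC]
  split_ifs <;> rfl

lemma ValidClosed.of_addAtC {N : ℕ} {c : ZMod N → Bool} {p : ZMod N}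
    (h : ValidClosed N (addAtC c p)) : ValidClosed N c := by
  have key : ∀ y, c y = true → addAtC c p y = true := fun y hy => by
    simp [addAtC, hy]
  exact fun x ⟨h0, h1, h2⟩ => h x ⟨key _ h0, key _ h1, key _ h2⟩

lemma signClosed_addAtC {N : ℕ} {c : ZMod N → Bool} {a b : ℕ} (ha : a ∈ Finset.Icc 1 N)
    (hb : b ∈ Finset.Icc 1 N) (hc : c a = false) :
    signClosed N (addAtC c a) b = if a < b then -signClosed N c b else signClosed N c b := by
  have ha' := Finset.mem_Icc.1 ha
  have hb' := Finset.mem_Icc.1 hb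
  have heq : ∀ y ∈ Finset.Ico 1 b, ((y : ZMod N) = a ↔ y = a) := fun y hy => by
    rw [Finset.mem_Ico] at hy
    exact natCast_zmod_inj_of_mem_Icc (Finset.mem_Icc.2 ⟨hy.1, by omega⟩) ha
  unfold signClosed
  split_ifs with hab
  · have hset : (Finset.Ico 1 b).filter (fun y : ℕ => addAtC c a (y : ZMod N) = true) =
        insert a ((Finset.Ico 1 b).filter (fun y : ℕ => c (y : ZMod N) = true)) := by
      ext y
      simp only [Finset.mem_filter, Finset.mem_insert]
      constructor
      · rintro ⟨hy, h⟩
        by_cases hya : y = a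
        · exact Or.inl hya
        · exact Or.inr ⟨hy, by simpa [addAtC, heq y hy, hya] using h⟩
      · rintro (rfl | ⟨hy, h⟩)
        · exact ⟨Finset.mem_Ico.2 ⟨ha'.1, hab⟩, by simp [addAtC]⟩
        · exact ⟨hy, by simp [addAtC, h]⟩
    rw [hset, Finset.card_insert_of_notMem (by simp [hc]), pow_succ, mul_neg_one]
  · congr 2
    refine Finset.filter_congr fun y hy => ?_
    have hya : y ≠ a := by
      rw [Finset.mem_Ico] at hy
      omega
    simp [addAtC, heq y hy, hya]

lemma signClosed_mul_signClosed_addAtC {N : ℕ} {c : ZMod N → Bool} {a b : ℕ}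
    (ha : a ∈ Finset.Icc 1 N) (hb : b ∈ Finset.Icc 1 N) (hab : a ≠ b)
    (hca : c a = false) (hcb : c b = false) :
    signClosed N c a * signClosed N (addAtC c a) b =
      -(signClosed N c b * signClosed N (addAtC c b) a) := by
  rw [signClosed_addAtC ha hb hca, signClosed_addAtC hb ha hcb]
  rcases lt_or_gt_of_ne hab with h | h
  · rw [if_pos h, if_neg h.not_gt]; ring
  · rw [if_neg h.not_gt, if_pos h]; ring

lemma signClosed_ne_zero (N : ℕ) (c : ZMod N → Bool) (a : ℕ) : signClosed N c a ≠ 0 :=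
  pow_ne_zero _ (by norm_num)

section Amplitudes

variable {N : ℕ} {l11 l21 l22 : ZMod N → ℝ} {c : ZMod N → Bool}

lemma ampQ_mul_ampQ_succ (hN : 3 ≤ N) {p : ZMod N} (hp : c p = false)
    (hq : c (p + 1) = false) (hv : ValidClosed N (addAtC (addAtC c p) (p + 1))) :
    ampQ l11 l21 l22 (addAtC c p) p *
        ampQ l11 l21 l22 (addAtC (addAtC c p) (p + 1)) (p + 1) =
      ((l11 p * l22 (p + 1) : ℝ) : ℂ) ∧
    ampQ l11 l21 l22 (addAtC c (p + 1)) (p + 1) *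
        ampQ l11 l21 l22 (addAtC (addAtC c (p + 1)) p) p =
      ((l11 (p + 1) * l21 p : ℝ) : ℂ) := by
  have h1 := zmod_one_ne_zero hN
  have h2 := zmod_two_ne_zero hN
  have hpred : c (p - 1) = false := by
    have e1 : p - 1 + 1 = p := by ring
    have e2 : p - 1 + 2 = p + 1 := by ring
    have h := hv (p - 1)
    rw [e1, e2] at h
    by_contra hc
    exact h (by simp_all [addAtC])
  have e3 : p + 1 + 1 = p + 2 := by ring
  have hsucc : c (p + 2) = false := by
    have h := hv p
    by_contra hc
    exact h (by simp_all [addAtC])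
  have h12 : p + 2 ≠ p + 1 := fun h => h1 (by linear_combination h)
  constructor <;> simp [ampQ, addAtC, e3, h1, h2, h12, hp, hq, hpred, hsucc]

lemma ampQ_mul_ampQ_comm (hN : 3 ≤ N)
    (hl : ∀ x : ZMod N, l11 (x + 1) * l21 x = l11 x * l22 (x + 1)) {p q : ZMod N}
    (hp : c p = false) (hq : c q = false) (hv : ValidClosed N (addAtC (addAtC c p) q)) :
    ampQ l11 l21 l22 (addAtC c p) p * ampQ l11 l21 l22 (addAtC (addAtC c p) q) q =
      ampQ l11 l21 l22 (addAtC c q) q * ampQ l11 l21 l22 (addAtC (addAtC c q) p) p := by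
  by_cases hpq : q = p + 1
  · subst hpq
    obtain ⟨e, e'⟩ := ampQ_mul_ampQ_succ (l11 := l11) (l21 := l21) (l22 := l22) hN hp hq hv
    rw [e, e', hl]
  by_cases hqp : p = q + 1
  · subst hqp
    rw [addAtC_comm] at hv
    obtain ⟨e, e'⟩ := ampQ_mul_ampQ_succ (l11 := l11) (l21 := l21) (l22 := l22) hN hq hp hv
    rw [e, e', hl]
  have h1 := zmod_one_ne_zero hN
  have hpq' : p - 1 ≠ q := fun h => hqp (by linear_combination h)
  have hqp' : q - 1 ≠ p := fun h => hpq (by linear_combination h)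
  simp [ampQ, addAtC, h1, Ne.symm hpq, Ne.symm hqp, hpq', hqp', mul_comm]

end Amplitudes

/-- The contribution to `(Q₊² ψ) c` of the particles at `a` and `b`. -/
noncomputable def pairTerm {N : ℕ} [NeZero N] (l11 l21 l22 : ZMod N → ℝ)
    (ψ : (ZMod N → Bool) → ℂ) (c : ZMod N → Bool) (a b : ℕ) : ℂ :=
  if c a = false ∧ c b = false ∧ a ≠ b ∧ ValidClosed N (addAtC (addAtC c a) b) then
    signClosed N c a * signClosed N (addAtC c a) b *
      (ampQ l11 l21 l22 (addAtC c a) a * ampQ l11 l21 l22 (addAtC (addAtC c a) b) b) *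
      ψ (addAtC (addAtC c a) b)
  else 0

lemma sum_sum_eq_pairTerm {N : ℕ} [NeZero N] {l11 l21 l22 : ZMod N → ℝ}
    {Qp : ((ZMod N → Bool) → ℂ) →ₗ[ℂ] ((ZMod N → Bool) → ℂ)}
    (hQp : ∀ ψ c, ValidClosed N c →
      Qp ψ c = ∑ x ∈ (Finset.Icc 1 N).filter
          (fun x : ℕ => c (x : ZMod N) = false ∧ ValidClosed N (addAtC c (x : ZMod N))),
        signClosed N c x * ampQ l11 l21 l22 (addAtC c (x : ZMod N)) (x : ZMod N) *
          ψ (addAtC c (x : ZMod N)))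
    (ψ : (ZMod N → Bool) → ℂ) {c : ZMod N → Bool} (hc : ValidClosed N c) :
    Qp (Qp ψ) c =
      ∑ a ∈ Finset.Icc 1 N, ∑ b ∈ Finset.Icc 1 N, pairTerm l11 l21 l22 ψ c a b := by
  rw [hQp _ c hc, Finset.sum_filter]
  refine Finset.sum_congr rfl fun a ha => ?_
  split_ifs with h
  · rw [hQp _ _ h.2, Finset.sum_filter, Finset.mul_sum]
    refine Finset.sum_congr rfl fun b hb => ?_
    have hiff : (addAtC c a (b : ZMod N) = false ∧ ValidClosed N (addAtC (addAtC c a) b)) ↔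
        (c a = false ∧ c b = false ∧ a ≠ b ∧ ValidClosed N (addAtC (addAtC c a) b)) := by
      have hba := natCast_zmod_inj_of_mem_Icc hb ha
      by_cases hab : b = a
      · subst hab
        simp [addAtC]
      · simp [addAtC, hba, hab, Ne.symm hab, h.1]
    rw [pairTerm]
    simp only [hiff]
    split_ifs
    · ring
    · simp
  · refine (Finset.sum_eq_zero fun b _ => if_neg fun hv => h ⟨hv.1, ?_⟩).symm
    exact hv.2.2.2.of_addAtC

/-- for the closed chain of `N ≥ 6` sites, the supercharge `Q₊` of the M₂
model with positive weights `λ_{1,1,x}, λ_{2,1,x}, λ_{2,2,x}` is nilpotent, `Q₊² = 0`,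
if and only if `λ_{1,1,x+1} λ_{2,1,x} = λ_{1,1,x} λ_{2,2,x+1}` for every `x`. -/
theorem stmt3 (N : ℕ) [NeZero N] (hN : 6 ≤ N) (l11 l21 l22 : ZMod N → ℝ)
    (h11 : ∀ x, 0 < l11 x) (h21 : ∀ x, 0 < l21 x) (h22 : ∀ x, 0 < l22 x)
    (Qp : ((ZMod N → Bool) → ℂ) →ₗ[ℂ] ((ZMod N → Bool) → ℂ))
    (hQp : ∀ ψ c, ValidClosed N c →
      Qp ψ c = ∑ x ∈ (Finset.Icc 1 N).filter
          (fun x : ℕ => c (x : ZMod N) = false ∧ ValidClosed N (addAtC c (x : ZMod N))),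
        signClosed N c x * ampQ l11 l21 l22 (addAtC c (x : ZMod N)) (x : ZMod N) *
          ψ (addAtC c (x : ZMod N)))
    (hQp0 : ∀ ψ c, ¬ ValidClosed N c → Qp ψ c = 0) :
    Qp ∘ₗ Qp = 0 ↔ ∀ x : ZMod N, l11 (x + 1) * l21 x = l11 x * l22 (x + 1) := by
  have hN3 : 3 ≤ N := by omega
  constructor
  · intro hQ x
    obtain ⟨a, ha, rfl⟩ := exists_mem_Icc_natCast_eq x
    obtain ⟨b, hb, hab⟩ := exists_mem_Icc_natCast_eq ((a : ZMod N) + 1)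
    have h1 := zmod_one_ne_zero hN3
    have h2 := zmod_two_ne_zero hN3
    have hne : a ≠ b := by
      rintro rfl
      exact h1 (by linear_combination -hab)
    set c : ZMod N → Bool := fun _ => false with hc
    set d := addAtC (addAtC c a) b with hd
    have hd' : addAtC (addAtC c b) a = d := addAtC_comm _ _ _
    have hdv : ValidClosed N d := by
      rintro y ⟨hy0, hy1, hy2⟩
      simp only [hd, addAtC, hc, hab] at hy0 hy1 hy2
      have h0 : y = a + 1 ∨ y = a := by simpa [ite_eq_iff] using hy0
      rcases h0 with rfl | rfl
      · have : (a : ZMod N) + 1 + 1 ≠ a := fun h => h2 (by linear_combination h)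
        simp [h1, this] at hy1
      · have : (a : ZMod N) + 2 ≠ a + 1 := fun h => h1 (by linear_combination h)
        simp [h2, this] at hy2
    have hcv : ValidClosed N c := fun y h => by simp [hc] at h
    have hzero := congrFun (LinearMap.congr_fun hQ (Pi.single d 1)) c
    rw [LinearMap.comp_apply, sum_sum_eq_pairTerm hQp _ hcv, ← Finset.sum_product'] at hzero
    have hsub : ({(a, b), (b, a)} : Finset (ℕ × ℕ)) ⊆
        Finset.Icc 1 N ×ˢ Finset.Icc 1 N := by
      simp only [Finset.insert_subset_iff, Finset.singleton_subset_iff, Finset.mem_product]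
      exact ⟨⟨ha, hb⟩, hb, ha⟩
    rw [← Finset.sum_subset hsub ?_, Finset.sum_pair (by simp [hne])] at hzero
    · obtain ⟨e, e'⟩ := ampQ_mul_ampQ_succ (l11 := l11) (l21 := l21) (l22 := l22)
        (c := c) (p := a) hN3 rfl rfl (by rw [← hab]; exact hdv)
      rw [← hab] at e e'
      rw [pairTerm, pairTerm, if_pos ⟨rfl, rfl, hne, hdv⟩,
        if_pos ⟨rfl, rfl, hne.symm, by rw [hd']; exact hdv⟩, e, e',
        signClosed_mul_signClosed_addAtC ha hb hne rfl rfl, hd', ← hd, Pi.single_eq_same] at hzero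
      have hs : signClosed N c b * signClosed N (addAtC c b) a ≠ 0 :=
        mul_ne_zero (signClosed_ne_zero _ _ _) (signClosed_ne_zero _ _ _)
      have hprod : signClosed N c b * signClosed N (addAtC c b) a *
          (((l11 b * l21 a : ℝ) : ℂ) - ((l11 a * l22 b : ℝ) : ℂ)) = 0 := by
        simp only [LinearMap.zero_apply, Pi.zero_apply] at hzero
        linear_combination hzero
      rw [← hab]
      exact_mod_cast sub_eq_zero.1 ((mul_eq_zero.1 hprod).resolve_left hs)
    · rintro ⟨i, j⟩ hij hnot
      rw [Finset.mem_product] at hij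
      rw [pairTerm]
      split_ifs with h
      · suffices hij' : addAtC (addAtC c i) j ≠ d by simp [Pi.single_eq_of_ne hij']
        intro heq
        have mem : ∀ k ∈ Finset.Icc 1 N, d k = true → k = a ∨ k = b := fun k hk hdk => by
          simp only [hd, addAtC, hc, natCast_zmod_inj_of_mem_Icc hk ha,
            natCast_zmod_inj_of_mem_Icc hk hb] at hdk
          by_contra! hcon
          simp [hcon.1, hcon.2] at hdk
        have hi := mem i hij.1 (by rw [← heq]; simp [addAtC])
        have hj := mem j hij.2 (by rw [← heq]; simp [addAtC])
        have hij_ne := h.2.2.1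
        simp only [Finset.mem_insert, Finset.mem_singleton, Prod.mk.injEq] at hnot
        omega
      · rfl
  · intro hl
    refine LinearMap.ext fun ψ => funext fun c => ?_
    rw [LinearMap.comp_apply, LinearMap.zero_apply, Pi.zero_apply]
    by_cases hc : ValidClosed N c
    · rw [sum_sum_eq_pairTerm hQp ψ hc]
      have hanti : ∀ a ∈ Finset.Icc 1 N, ∀ b ∈ Finset.Icc 1 N,
          pairTerm l11 l21 l22 ψ c a b = -pairTerm l11 l21 l22 ψ c b a := by
        intro a ha b hb
        rw [pairTerm, pairTerm, addAtC_comm c b a]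
        by_cases h : c a = false ∧ c b = false ∧ a ≠ b ∧
            ValidClosed N (addAtC (addAtC c a) b)
        · rw [if_pos h, if_pos ⟨h.2.1, h.1, h.2.2.1.symm, h.2.2.2⟩,
            signClosed_mul_signClosed_addAtC ha hb h.2.2.1 h.1 h.2.1,
            ampQ_mul_ampQ_comm hN3 hl h.1 h.2.1 h.2.2.2, addAtC_comm c b a]
          ring
        · rw [if_neg h, if_neg fun h' => h ⟨h'.2.1, h'.1, h'.2.2.1.symm, h'.2.2.2⟩, neg_zero]
      refine self_eq_neg.1 ?_
      conv_rhs => rw [Finset.sum_comm, ← Finset.sum_neg_distrib]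
      refine Finset.sum_congr rfl fun a ha => ?_
      rw [← Finset.sum_neg_distrib]
      exact Finset.sum_congr rfl fun b hb => hanti a ha b hb
    · exact hQp0 _ _ hc
end

section
/- Fix 0 < q < 1, θ = π/4, and t ∈ ℝ, and define λ_x², μ_x² as in the elliptic parametrisation. Then for every integer x: λ_x² λ_{x+1}² μ_x² μ_{x+1}² = 4 (θ1(θ)/θ1(2θ))⁸, i.e. the product λ_x λ_{x+1} μ_x μ_{x+1} equals the constant Λ = 2 (θ1(θ)/θ1(2θ))⁴, independently of x and of t. -/
/-- The Jacobi theta function `θ₁(u,q) = −i Σ_{j∈ℤ} (−1)^j q^{(j+1/2)²} e^{(2j+1)iu}`. -/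
noncomputable def th1 (q u : ℂ) : ℂ :=
  -Complex.I * ∑' j : ℤ, (-1 : ℂ) ^ j * q ^ (((j : ℂ) + 1 / 2) ^ 2) *
    Complex.exp ((2 * (j : ℂ) + 1) * Complex.I * u)

/-- The Jacobi theta function `θ₄(u,q) = Σ_{j∈ℤ} (−1)^j q^{j²} e^{2iju}`. -/
noncomputable def th4 (q u : ℂ) : ℂ :=
  ∑' j : ℤ, (-1 : ℂ) ^ j * q ^ ((j : ℂ) ^ 2) * Complex.exp (2 * (j : ℂ) * Complex.I * u)

/-- `θ = π/4`. -/
noncomputable def thet : ℂ := (Real.pi : ℂ) / 4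

/-- `μ_x²` of the elliptic parametrisation. -/
noncomputable def musq (q t : ℝ) (x : ℤ) : ℂ :=
  (th1 (q : ℂ) thet / th1 (q : ℂ) (2 * thet)) ^ 2 *
    th4 (q : ℂ) ((t : ℂ) + 2 * (x : ℂ) * thet) ^ 2 /
    (th4 (q : ℂ) ((t : ℂ) + (2 * (x : ℂ) - 1) * thet) *
      th4 (q : ℂ) ((t : ℂ) + (2 * (x : ℂ) + 1) * thet))

/-- `λ_x²` of the elliptic parametrisation. -/
noncomputable def lamsq (q t : ℝ) (x : ℤ) : ℂ :=
  2 * (th1 (q : ℂ) thet / th1 (q : ℂ) (2 * thet)) ^ 2 *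
    th4 (q : ℂ) ((t : ℂ) + (2 * (x : ℂ) - 1) * thet) ^ 2 /
    (th4 (q : ℂ) ((t : ℂ) + 2 * ((x : ℂ) - 1) * thet) *
      th4 (q : ℂ) ((t : ℂ) + 2 * (x : ℂ) * thet))

open Complex in
/-- For `q ≠ 0`, `θ₄` is Mathlib's two-variable Jacobi theta function, shifted by half a period. -/
theorem th4_eq_jacobiTheta₂ {q : ℂ} (hq : q ≠ 0) (u : ℂ) :
    th4 q u = jacobiTheta₂ (u / Real.pi + 1 / 2) (-I * log q / Real.pi) := by
  have hpi : (Real.pi : ℂ) ≠ 0 := ofReal_ne_zero.mpr Real.pi_ne_zero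
  refine tsum_congr fun j => ?_
  rw [jacobiTheta₂_term, ← exp_pi_mul_I, ← exp_int_mul, cpow_def_of_ne_zero hq, ← exp_add,
    ← exp_add]
  congr 1
  field_simp
  linear_combination ((j : ℂ) ^ 2 * log q) * I_sq

open Complex in
theorem jacobiTheta₂_ofReal_div_I_mul_ne_zero (z : ℝ) {T : ℝ} (hT : 0 < T) :
    jacobiTheta₂ (z / (I * T)) (-1 / (I * T)) ≠ 0 := by
  have hT' : (T : ℂ) ≠ 0 := ofReal_ne_zero.mpr hT.ne'
  have hterm (n : ℤ) : jacobiTheta₂_term n (z / (I * T)) (-1 / (I * T)) =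
      (Real.exp (2 * Real.pi * n * z / T - Real.pi * n ^ 2 / T) : ℝ) := by
    rw [jacobiTheta₂_term]
    push_cast
    congr 1
    field_simp
    ring
  have him : 0 < (-1 / (I * T) : ℂ).im := by
    have : (-1 / (I * T) : ℂ) = ((1 / T : ℝ) : ℂ) * I := by
      push_cast
      field_simp
      simp
    rw [this, im_ofReal_mul, I_im, mul_one]
    positivity
  have hsum := (hasSum_jacobiTheta₂_term (z / (I * T)) him).summable
  simp only [hterm] at hsum
  rw [jacobiTheta₂, tsum_congr hterm, ← ofReal_tsum, ofReal_ne_zero]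
  exact ((summable_ofReal.mp hsum).tsum_pos (fun _ => (Real.exp_pos _).le) 0
    (Real.exp_pos _)).ne'

open Complex in
theorem th4_ofReal_ne_zero {q : ℝ} (hq : 0 < q) (hq1 : q < 1) (u : ℝ) :
    th4 (q : ℂ) (u : ℂ) ≠ 0 := by
  have hT : 0 < -Real.log q / Real.pi :=
    div_pos (neg_pos.mpr (Real.log_neg hq hq1)) Real.pi_pos
  have hz : (u / Real.pi + 1 / 2 : ℂ) = ((u / Real.pi + 1 / 2 : ℝ) : ℂ) := by
    push_cast
    rfl
  have hτ : -I * log (q : ℂ) / Real.pi = I * ((-Real.log q / Real.pi : ℝ) : ℂ) := by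
    rw [← ofReal_log hq.le]
    push_cast
    ring
  rw [th4_eq_jacobiTheta₂ (ofReal_ne_zero.mpr hq.ne'), hz, hτ, jacobiTheta₂_functional_equation]
  refine mul_ne_zero (mul_ne_zero (one_div_ne_zero ?_) (exp_ne_zero _))
    (jacobiTheta₂_ofReal_div_I_mul_ne_zero _ hT)
  rw [← mul_assoc, neg_mul, I_mul_I, neg_neg, one_mul, Ne, cpow_eq_zero_iff]
  exact fun h => ofReal_ne_zero.mpr hT.ne' h.1

open Complex in
theorem th4_add_pi (q u : ℂ) : th4 q (u + Real.pi) = th4 q u := by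
  refine tsum_congr fun j => ?_
  congr 1
  rw [← exp_periodic.int_mul j (2 * j * I * u)]
  congr 1
  ring

/-- on the elliptic parametrisation (with `0 < q < 1`, `θ = π/4`, real `t`),
`λ_x² λ_{x+1}² μ_x² μ_{x+1}² = 4 (θ₁(θ)/θ₁(2θ))⁸` for every integer `x`, i.e. the product
`λ_x λ_{x+1} μ_x μ_{x+1}` equals the constant `Λ = 2 (θ₁(θ)/θ₁(2θ))⁴`, independently of
`x` and of `t`. -/
theorem stmt5 (q t : ℝ) (hq : 0 < q) (hq1 : q < 1) :
    ∀ x : ℤ, lamsq q t x * lamsq q t (x + 1) * musq q t x * musq q t (x + 1) =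
      4 * (th1 (q : ℂ) thet / th1 (q : ℂ) (2 * thet)) ^ 8 := by
  intro x
  have hne (n : ℤ) : th4 (q : ℂ) ((t : ℂ) + n * thet) ≠ 0 := by
    have := th4_ofReal_ne_zero hq hq1 (t + n * (Real.pi / 4))
    rw [thet]
    exact_mod_cast this
  have h₀ := hne (2 * x)
  have h₁ := hne (2 * x - 1)
  have h₂ := hne (2 * x + 1)
  have h₃ := hne (2 * (x - 1))
  have hper (u v : ℂ) (h : v = u + 4 * thet) : th4 q v = th4 q u := by
    rw [h, ← th4_add_pi q u, thet]
    ring_nf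
  push_cast at h₀ h₁ h₂ h₃
  simp only [lamsq, musq]
  push_cast
  rw [hper (t + 2 * (x - 1) * thet) (t + 2 * (x + 1) * thet) (by ring),
    hper (t + (2 * x - 1) * thet) (t + (2 * (x + 1) + 1) * thet) (by ring),
    show (2 * ((x : ℂ) + 1) - 1) = 2 * x + 1 by ring,
    show (2 * ((x : ℂ) + 1 - 1)) = 2 * x by ring]
  generalize th1 (q : ℂ) thet / th1 (q : ℂ) (2 * thet) = r
  generalize th4 (q : ℂ) (t + 2 * x * thet) = f₀ at *
  generalize th4 (q : ℂ) (t + (2 * x - 1) * thet) = f₁ at *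
  generalize th4 (q : ℂ) (t + (2 * x + 1) * thet) = f₂ at *
  generalize th4 (q : ℂ) (t + 2 * (x - 1) * thet) = f₃ at *
  field_simp
  ring
end
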